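/- Fix T ≥ 1, matrices A ∈ ℝ^{n×n}, H ∈ ℝ^{m×n}, and vectors y(0),…,y(T) ∈ ℝ^m. For L ∈ ℝ^{n×m} define A_L := A − L H, ŷ_L(T) := Σ_{t=0}^{T−1} H A_L^{T−t−1} L y(t), e_T(L) := y(T) − ŷ_L(T), and ε(L) := ‖e_T(L)‖². Then ε is differentiable in L and its gradient with respect to the Frobenius inner product is ∇ε(L) = −2 Σ_{t=0}^{T−1} (A_L^⊤)^{t} H^⊤ e_T(L) y(T−t−1)^⊤ + 2 Σ_{t=1}^{T−1} Σ_{k=1}^{t} (A_L^⊤)^{t−k} H^⊤ e_T(L) y(T−t−1)^⊤ L^⊤ (A_L^⊤)^{k−1} H^⊤. -/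

import Mathlib

open Matrix

attribute [local instance] Matrix.normedAddCommGroup Matrix.normedSpace

/-- The Frobenius pairing `E ↦ tr(Eᵀ G)` as a continuous linear functional. -/
noncomputable def pairing {n m : ℕ} (G : Matrix (Fin n) (Fin m) ℝ) :
    Matrix (Fin n) (Fin m) ℝ →L[ℝ] ℝ :=
  LinearMap.toContinuousLinearMap
    { toFun := fun E => Matrix.trace (Eᵀ * G)
      map_add' := fun a b => by simp [Matrix.transpose_add, Matrix.add_mul]
      map_smul' := fun c a => by simp [Matrix.transpose_smul, Matrix.smul_mul] }

/-- Output-prediction error `e_T(L) = y(T) − ŷ_L(T)` of the constant-gain filter with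
gain `L` on the fixed data sequence `y`. -/
noncomputable def epsErr {n m : ℕ} (T : ℕ) (A : Matrix (Fin n) (Fin n) ℝ)
    (H : Matrix (Fin m) (Fin n) ℝ) (y : ℕ → Fin m → ℝ)
    (L : Matrix (Fin n) (Fin m) ℝ) : Fin m → ℝ :=
  y T - ∑ t ∈ Finset.range T, (H * (A - L * H) ^ (T - t - 1) * L).mulVec (y t)

/-- `F` has Fréchet derivative at `L` acting as `d`. -/
def HasD {V W : Type*} [NormedAddCommGroup V] [NormedSpace ℝ V] [NormedAddCommGroup W]
    [NormedSpace ℝ W] (F : V → W) (d : V → W) (L : V) : Prop :=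
  ∃ D : V →L[ℝ] W, HasFDerivAt F D L ∧ ∀ E, D E = d E

theorem HasD.linear {V W : Type*} [NormedAddCommGroup V] [NormedSpace ℝ V]
    [NormedAddCommGroup W] [NormedSpace ℝ W] {U : Type*} [NormedAddCommGroup U]
    [NormedSpace ℝ U] [FiniteDimensional ℝ W] (f : W →ₗ[ℝ] U) {F : V → W} {d : V → W} {L : V}
    (h : HasD F d L) : HasD (fun x => f (F x)) (fun E => f (d E)) L := by
  obtain ⟨D, hD, hd⟩ := h
  refine ⟨(LinearMap.toContinuousLinearMap f).comp D,
    (LinearMap.toContinuousLinearMap f).hasFDerivAt.comp L hD, fun E => ?_⟩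
  simp [hd]

theorem HasD.mul {V : Type*} [NormedAddCommGroup V] [NormedSpace ℝ V] {a b c : ℕ}
    {F : V → Matrix (Fin a) (Fin b) ℝ} {G : V → Matrix (Fin b) (Fin c) ℝ}
    {dF : V → Matrix (Fin a) (Fin b) ℝ} {dG : V → Matrix (Fin b) (Fin c) ℝ} {L : V}
    (hF : HasD F dF L) (hG : HasD G dG L) :
    HasD (fun x => F x * G x) (fun E => dF E * G L + F L * dG E) L := by
  obtain ⟨D, hD, hd⟩ := hF
  obtain ⟨D', hD', hd'⟩ := hG
  let B : Matrix (Fin a) (Fin b) ℝ →ₗ[ℝ] Matrix (Fin b) (Fin c) ℝ →ₗ[ℝ]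
      Matrix (Fin a) (Fin c) ℝ :=
    LinearMap.mk₂ ℝ (fun M N => M * N) Matrix.add_mul Matrix.smul_mul Matrix.mul_add
      (fun c M N => Matrix.mul_smul M c N)
  let B' := LinearMap.toContinuousLinearMap
    ((LinearMap.toContinuousLinearMap : _ ≃ₗ[ℝ] (Matrix (Fin b) (Fin c) ℝ →L[ℝ]
      Matrix (Fin a) (Fin c) ℝ)).toLinearMap ∘ₗ B)
  have hB : ∀ M N, B' M N = M * N := fun M N => rfl
  have := B'.hasFDerivAt_of_bilinear hD hD'
  refine ⟨_, this, fun E => ?_⟩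
  change B' (F L) (D' E) + B' (D E) (G L) = dF E * G L + F L * dG E
  rw [hB, hB, hd, hd', add_comm]

theorem HasD.pow {V : Type*} [NormedAddCommGroup V] [NormedSpace ℝ V] {n : ℕ}
    {F : V → Matrix (Fin n) (Fin n) ℝ}
    {dF : V → Matrix (Fin n) (Fin n) ℝ} {L : V}
    (hF : HasD F dF L) (s : ℕ) :
    HasD (fun x => F x ^ s)
      (fun E => ∑ k ∈ Finset.range s, F L ^ (s - (k + 1)) * dF E * F L ^ k) L := by
  induction s with
  | zero => exact ⟨0, by simpa using hasFDerivAt_const _ _, by simp⟩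
  | succ s ih =>
    obtain ⟨D, hD, hd⟩ := ih.mul hF
    refine ⟨D, by simpa only [pow_succ] using hD, fun E => ?_⟩
    rw [hd]
    beta_reduce
    rw [Finset.sum_range_succ', Finset.sum_mul]
    simp [pow_succ, Matrix.mul_assoc]

theorem HasD.const {V W : Type*} [NormedAddCommGroup V] [NormedSpace ℝ V]
    [NormedAddCommGroup W] [NormedSpace ℝ W] (c : W) (L : V) :
    HasD (fun _ => c) (fun _ => 0) L := ⟨0, hasFDerivAt_const _ _, by simp⟩

theorem HasD.id {V : Type*} [NormedAddCommGroup V] [NormedSpace ℝ V] (L : V) :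
    HasD (fun x => x) (fun E => E) L := ⟨_, hasFDerivAt_id _, by simp⟩

theorem HasD.sub {V W : Type*} [NormedAddCommGroup V] [NormedSpace ℝ V]
    [NormedAddCommGroup W] [NormedSpace ℝ W] {F G dF dG : V → W} {L : V}
    (hF : HasD F dF L) (hG : HasD G dG L) :
    HasD (fun x => F x - G x) (fun E => dF E - dG E) L := by
  obtain ⟨D, hD, hd⟩ := hF
  obtain ⟨D', hD', hd'⟩ := hG
  exact ⟨_, hD.sub hD', by simp [hd, hd']⟩

theorem HasD.sum {V W : Type*} [NormedAddCommGroup V] [NormedSpace ℝ V]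
    [NormedAddCommGroup W] [NormedSpace ℝ W] {ι : Type*} {s : Finset ι} {F dF : ι → V → W} {L : V}
    (hF : ∀ i, HasD (F i) (dF i) L) :
    HasD (fun x => ∑ i ∈ s, F i x) (fun E => ∑ i ∈ s, dF i E) L := by
  choose D hD hd using hF
  exact ⟨_, HasFDerivAt.fun_sum fun i _ => hD i, by simp [hd]⟩

theorem HasD.sq {V : Type*} [NormedAddCommGroup V] [NormedSpace ℝ V]
    {F dF : V → ℝ} {L : V} (hF : HasD F dF L) :
    HasD (fun x => F x ^ 2) (fun E => 2 * F L * dF E) L := by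
  obtain ⟨D, hD, hd⟩ := hF
  exact ⟨_, hD.pow 2, by simp [hd]⟩

theorem HasD.err {n m : ℕ} (T : ℕ)
    (A : Matrix (Fin n) (Fin n) ℝ) (H : Matrix (Fin m) (Fin n) ℝ)
    (y : ℕ → Fin m → ℝ) (L : Matrix (Fin n) (Fin m) ℝ) :
    HasD (epsErr T A H y) (fun E => ∑ s ∈ Finset.range T,
      ((∑ k ∈ Finset.range s, (H * (A - L * H) ^ (s - (k + 1)) * E * H * (A - L * H) ^ k * L).mulVec
        (y (T - s - 1))) - (H * (A - L * H) ^ s * E).mulVec (y (T - s - 1)))) L := by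
  have h1 : HasD (fun X : Matrix (Fin n) (Fin m) ℝ => A - X * H) _ L :=
    (HasD.const A L).sub ((HasD.id L).mul (HasD.const H L))
  have h2 := fun s => ((HasD.const H L).mul (h1.pow s)).mul (HasD.id L)
  have h3 := fun s : ℕ => (h2 s).linear
    ((Matrix.mulVecBilin ℝ ℝ).flip (y (T - s - 1)) : Matrix (Fin m) (Fin m) ℝ →ₗ[ℝ] Fin m → ℝ)
  obtain ⟨D, hD, hd⟩ := (HasD.const (y T) L).sub (HasD.sum (s := Finset.range T) h3)
  refine ⟨D, ?_, fun E => ?_⟩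
  · convert hD using 1
    funext X
    simp only [epsErr]
    congr 1
    rw [← Finset.sum_range_reflect]
    refine Finset.sum_congr rfl fun s hs => ?_
    have := Finset.mem_range.1 hs
    have e1 : T - (T - 1 - s) - 1 = s := by omega
    have e2 : T - 1 - s = T - s - 1 := by omega
    rw [e1, e2]
    rfl
  · rw [hd]
    beta_reduce
    rw [zero_sub, ← Finset.sum_neg_distrib]
    refine Finset.sum_congr rfl fun s _ => ?_
    simp [Matrix.add_mulVec, Matrix.mul_sum, Matrix.sum_mul, Matrix.sum_mulVec, Matrix.neg_mulVec,
      Matrix.mul_assoc]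
    abel

theorem trace_vmv {n m : ℕ} (E : Matrix (Fin n) (Fin m) ℝ) (M : Matrix (Fin m) (Fin n) ℝ)
    (e v : Fin m → ℝ) :
    Matrix.trace (Eᵀ * Matrix.vecMulVec (Mᵀ.mulVec e) v) = e ⬝ᵥ (M * E).mulVec v := by
  rw [Matrix.mul_vecMulVec, Matrix.trace_vecMulVec, Matrix.mulVec_mulVec, ← Matrix.transpose_mul,
    Matrix.mulVec_transpose, Matrix.dotProduct_mulVec]

theorem grad_eps_formula
    {n m : ℕ} (T : ℕ) (hT : 1 ≤ T)
    (A : Matrix (Fin n) (Fin n) ℝ) (H : Matrix (Fin m) (Fin n) ℝ)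
    (y : ℕ → Fin m → ℝ) (L : Matrix (Fin n) (Fin m) ℝ) :
    HasFDerivAt (fun L' : Matrix (Fin n) (Fin m) ℝ => ∑ i, (epsErr T A H y L' i) ^ 2)
      (pairing (
        (-2 : ℝ) • (∑ t ∈ Finset.range T,
          Matrix.vecMulVec
            (((((A - L * H)ᵀ) ^ t) * Hᵀ).mulVec (epsErr T A H y L))
            (y (T - t - 1)))
        + (2 : ℝ) • (∑ t ∈ Finset.Icc 1 (T - 1), ∑ k ∈ Finset.Icc 1 t,
          Matrix.vecMulVec
            (((((A - L * H)ᵀ) ^ (t - k)) * Hᵀ).mulVec (epsErr T A H y L))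
            (y (T - t - 1))
          * (Lᵀ * (((A - L * H)ᵀ) ^ (k - 1)) * Hᵀ)))) L := by
  obtain ⟨D, hD, hd⟩ := HasD.sum (s := Finset.univ) fun i : Fin m =>
    ((HasD.err T A H y L).linear (LinearMap.proj i : (Fin m → ℝ) →ₗ[ℝ] ℝ)).sq
  refine HasFDerivAt.congr_fderiv hD (ContinuousLinearMap.ext fun E => ?_)
  rw [hd]
  symm
  have hIcc : ∀ (t : ℕ) (f : ℕ → Matrix (Fin n) (Fin m) ℝ),
      ∑ k ∈ Finset.Icc 1 t, f k = ∑ k ∈ Finset.range t, f (k + 1) := by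
    intro t f
    rw [Finset.range_eq_Ico, Finset.sum_Ico_add' f 0 t 1]
    rfl
  have hout : ∀ (f : ℕ → Matrix (Fin n) (Fin m) ℝ), f 0 = 0 →
      ∑ t ∈ Finset.Icc 1 (T - 1), f t = ∑ t ∈ Finset.range T, f t := by
    intro f hf
    obtain ⟨S, rfl⟩ : ∃ S, T = S + 1 := ⟨T - 1, by omega⟩
    rw [hIcc, Finset.sum_range_succ', hf, add_zero]
    rfl
  rw [hout _ (by simp)]
  simp_rw [hIcc]
  generalize hee : epsErr T A H y L = e
  have hR : ∀ w : Fin m → ℝ, ∑ i, 2 * e i * w i = 2 * (e ⬝ᵥ w) := by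
    intro w
    simp [dotProduct, Finset.mul_sum, mul_assoc]
  refine Eq.trans ?_ (hR _).symm
  have hp : ∀ G : Matrix (Fin n) (Fin m) ℝ, pairing G E = Matrix.trace (Eᵀ * G) := fun _ => rfl
  have k1 : ∀ t, Matrix.trace (Eᵀ * Matrix.vecMulVec ((((A - L * H)ᵀ ^ t) * Hᵀ).mulVec e)
      (y (T - t - 1))) = e ⬝ᵥ (H * (A - L * H) ^ t * E).mulVec (y (T - t - 1)) := by
    intro t
    rw [← trace_vmv, Matrix.transpose_mul, Matrix.transpose_pow]
  have k2 : ∀ t k, Matrix.trace (Eᵀ * (Matrix.vecMulVec ((((A - L * H)ᵀ ^ (t - (k + 1))) * Hᵀ).mulVec e)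
      (y (T - t - 1)) * (Lᵀ * (((A - L * H)ᵀ) ^ (k + 1 - 1)) * Hᵀ))) =
      e ⬝ᵥ (H * (A - L * H) ^ (t - (k + 1)) * E * H * (A - L * H) ^ k * L).mulVec
        (y (T - t - 1)) := by
    intro t k
    have : Lᵀ * (((A - L * H)ᵀ) ^ (k + 1 - 1)) * Hᵀ = (H * (A - L * H) ^ k * L)ᵀ := by
      simp [Matrix.transpose_mul, Matrix.transpose_pow, Matrix.mul_assoc]
    rw [this, Matrix.vecMulVec_mul, Matrix.vecMul_transpose, ← Matrix.transpose_pow,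
      ← Matrix.transpose_mul, trace_vmv, Matrix.mulVec_mulVec]
    simp only [Matrix.mul_assoc]
  refine (hp _).trans ?_
  change _ = 2 * (e ⬝ᵥ (∑ s ∈ Finset.range T,
      ((∑ k ∈ Finset.range s, (H * (A - L * H) ^ (s - (k + 1)) * E * H * (A - L * H) ^ k * L).mulVec
        (y (T - s - 1))) - (H * (A - L * H) ^ s * E).mulVec (y (T - s - 1)))))
  rw [Matrix.mul_add, Matrix.trace_add, Matrix.mul_smul, Matrix.mul_smul, Matrix.trace_smul,
    Matrix.trace_smul]
  simp only [Matrix.mul_sum, Matrix.trace_sum, k1, k2, dotProduct_sum, dotProduct_sub,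
    Finset.sum_sub_distrib, smul_eq_mul]
  ring
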